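/- Let C₁ = {A ∈ ℝ^{n×k} : A ≥ 0 entrywise} and C₂ = {A ∈ ℝ^{n×k} : ‖A‖_F ≤ √β}. Then for any M ∈ ℝ^{n×k}, the Euclidean projection onto C₁ ∩ C₂ equals the projection onto C₂ of the projection onto C₁, i.e., P_{C₁∩C₂}(M) = P_{C₂}([M]₊), where [M]₊ is the entrywise positive part and P_{C₂}(B) = min(1, √β/‖B‖_F)·B. -/

import Mathlib

open Finset

/-- The projection onto the intersection of the nonnegative orthant `C₁` and the
Frobenius ball `C₂` equals the radial projection onto `C₂` of the entrywise
positive part `[M]₊`: `P_{C₁∩C₂}(M) = min(1, √β/‖[M]₊‖_F)·[M]₊`. -/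
theorem stmt_11 (n k : ℕ) (β : ℝ) (hβ : 0 < β) (M : Matrix (Fin n) (Fin k) ℝ)
    (B : Matrix (Fin n) (Fin k) ℝ) (hB : ∀ i j, B i j = max (M i j) 0)
    (T : Matrix (Fin n) (Fin k) ℝ)
    (hT : T = min 1 (Real.sqrt β / Real.sqrt (∑ i, ∑ j, B i j ^ 2)) • B) :
    (∀ i j, 0 ≤ T i j) ∧
    Real.sqrt (∑ i, ∑ j, T i j ^ 2) ≤ Real.sqrt β ∧
    ∀ Z : Matrix (Fin n) (Fin k) ℝ, (∀ i j, 0 ≤ Z i j) →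
      Real.sqrt (∑ i, ∑ j, Z i j ^ 2) ≤ Real.sqrt β →
      ∑ i, ∑ j, (T - M) i j ^ 2 ≤ ∑ i, ∑ j, (Z - M) i j ^ 2 := by
  obtain ⟨S, hS⟩ : ∃ S, S = ∑ i, ∑ j, B i j ^ 2 := ⟨_, rfl⟩
  have hS0 : 0 ≤ S := by rw [hS]; positivity
  have hB0 : ∀ i j, 0 ≤ B i j := fun i j => by rw [hB]; exact le_max_right _ _
  have key : ∃ c : ℝ, 0 < c ∧ c ≤ 1 ∧ (∀ i j, T i j = c * B i j) ∧ c ^ 2 * S ≤ β ∧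
      (c = 1 ∨ c ^ 2 * S = β) := by
    rw [← hS] at hT
    rcases hS0.eq_or_lt with h0 | hpos
    · refine ⟨1, one_pos, le_rfl, ?_, by rw [← h0]; linarith, Or.inl rfl⟩
      intro i j
      have hz : B i j = 0 := by
        have h1 : B i j ^ 2 ≤ ∑ j, B i j ^ 2 :=
          Finset.single_le_sum (f := fun j => B i j ^ 2) (fun _ _ => sq_nonneg _)
            (Finset.mem_univ j)
        have h2 : ∑ j, B i j ^ 2 ≤ ∑ i, ∑ j, B i j ^ 2 :=
          Finset.single_le_sum (f := fun i => ∑ j, B i j ^ 2)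
            (fun _ _ => Finset.sum_nonneg fun _ _ => sq_nonneg _) (Finset.mem_univ i)
        have h3 : B i j ^ 2 ≤ 0 := by linarith
        exact pow_eq_zero_iff (two_ne_zero) |>.1 (le_antisymm h3 (sq_nonneg _))
      rw [hT]; simp [hz]
    · have hs : 0 < √S := Real.sqrt_pos.2 hpos
      have hb : 0 < √β := Real.sqrt_pos.2 hβ
      have hq : (√β / √S) ^ 2 * S = β := by
        rw [div_pow, Real.sq_sqrt hβ.le, Real.sq_sqrt hS0]; field_simp
      have hq0 : 0 < √β / √S := by positivity
      rcases le_total 1 (√β / √S) with h | h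
      · rw [min_eq_left h] at hT
        refine ⟨1, one_pos, le_rfl, fun i j => by rw [hT]; simp, ?_, Or.inl rfl⟩
        calc (1:ℝ) ^ 2 * S ≤ (√β / √S) ^ 2 * S := by gcongr
          _ = β := hq
      · rw [min_eq_right h] at hT
        exact ⟨_, hq0, h, fun i j => by rw [hT]; simp, hq.le, Or.inr hq⟩
  obtain ⟨c, hc0, hc1, hTc, hcS, hc⟩ := key
  have hTS : ∑ i, ∑ j, T i j ^ 2 = c ^ 2 * S := by
    rw [hS]; simp only [hTc, mul_pow, Finset.mul_sum]
  refine ⟨fun i j => by rw [hTc]; exact mul_nonneg hc0.le (hB0 i j), ?_, ?_⟩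
  · rw [hTS]; exact Real.sqrt_le_sqrt hcS
  · intro Z hZ hZn
    have hZβ : ∑ i, ∑ j, Z i j ^ 2 ≤ β := (Real.sqrt_le_sqrt_iff hβ.le).1 hZn
    have pt : ∀ i j, (1 - c) * (T i j ^ 2 - Z i j ^ 2) ≤
        c * ((Z - M) i j ^ 2 - (T - M) i j ^ 2) := by
      intro i j
      rw [Matrix.sub_apply, Matrix.sub_apply, hTc, hB]
      have hz := hZ i j
      generalize Z i j = z at *
      generalize M i j = m at *
      rcases le_total m 0 with h | h
      · rw [max_eq_right h]
        have h1 : 0 ≤ c * (z * (-m)) := by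
          have : 0 ≤ -m := by linarith
          positivity
        nlinarith [sq_nonneg z]
      · rw [max_eq_left h]
        nlinarith [sq_nonneg (z - c * m)]
    have hsum := Finset.sum_le_sum fun i (_ : i ∈ Finset.univ) =>
      Finset.sum_le_sum fun j (_ : j ∈ Finset.univ) => pt i j
    simp only [← Finset.mul_sum, Finset.sum_sub_distrib] at hsum
    rw [hTS] at hsum
    have h0 : 0 ≤ (1 - c) * (c ^ 2 * S - ∑ i, ∑ j, Z i j ^ 2) := by
      rcases hc with h | h
      · rw [h]; simp
      · rw [h]; exact mul_nonneg (by linarith) (by linarith)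
    have := nonneg_of_mul_nonneg_right (h0.trans hsum) hc0
    linarith
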